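/- If there are constants ā, b > 0 such that ‖Φ(t,τ)‖ ≤ ā for all 1 ≤ τ ≤ t+1 (where Φ(t,τ) := A(t)·A(t−1)⋯A(τ) for τ ≤ t and Φ(t,t+1) := I) and ‖B(τ)‖ ≤ b/τ for all τ ≥ 1, then the covariance sequence is uniformly bounded: for every t ≥ 0, ‖Σ(t)‖ ≤ ā²·‖Σ(0)‖ + ā²·‖Σ_θ‖·b²·π²/6. -/

import Mathlib

open Matrix Finset

/-- The ordered product `Φ(t,τ) = A(t)·A(t−1)⋯A(τ)` for `τ ≤ t`, with `Φ(t,t+1) = I`. -/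
def matProd (m : ℕ) (A : ℕ → Matrix (Fin m) (Fin m) ℝ) (t τ : ℕ) :
    Matrix (Fin m) (Fin m) ℝ :=
  (((List.range' τ (t + 1 - τ)).reverse).map A).prod

/-- The operator norm of a real matrix induced by the Euclidean norm. -/
noncomputable def matOpNorm {a b : ℕ} (M : Matrix (Fin a) (Fin b) ℝ) : ℝ :=
  ‖LinearMap.toContinuousLinearMap (Matrix.toEuclideanLin M)‖

section
open scoped Matrix.Norms.L2Operator

theorem matOpNorm_eq_l2 {a b : ℕ} (M : Matrix (Fin a) (Fin b) ℝ) : matOpNorm M = ‖M‖ := rfl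

theorem matOpNorm_nonneg' {a b : ℕ} (M : Matrix (Fin a) (Fin b) ℝ) : 0 ≤ matOpNorm M :=
  norm_nonneg _

theorem matOpNorm_sandwich {a b : ℕ} (M : Matrix (Fin a) (Fin b) ℝ)
    (N : Matrix (Fin b) (Fin b) ℝ) :
    matOpNorm (M * N * Mᵀ) ≤ matOpNorm M ^ 2 * matOpNorm N := by
  simp only [matOpNorm_eq_l2]
  have h1 := Matrix.l2_opNorm_mul (M * N) Mᵀ
  have h2 := Matrix.l2_opNorm_mul M N
  have h3 : ‖Mᵀ‖ = ‖M‖ := by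
    rw [← Matrix.conjTranspose_eq_transpose_of_trivial, Matrix.l2_opNorm_conjTranspose]
  rw [h3] at h1
  nlinarith [norm_nonneg M]

theorem matOpNorm_mul_le' {a b c : ℕ} (M : Matrix (Fin a) (Fin b) ℝ)
    (N : Matrix (Fin b) (Fin c) ℝ) : matOpNorm (M * N) ≤ matOpNorm M * matOpNorm N :=
  Matrix.l2_opNorm_mul M N

theorem matOpNorm_add_sum_le {a : ℕ} (M : Matrix (Fin a) (Fin a) ℝ)
    (f : ℕ → Matrix (Fin a) (Fin a) ℝ) (s : Finset ℕ) :
    matOpNorm (M + ∑ k ∈ s, f k) ≤ matOpNorm M + ∑ k ∈ s, matOpNorm (f k) := by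
  simp only [matOpNorm_eq_l2]
  exact (norm_add_le _ _).trans (by gcongr; exact norm_sum_le _ _)
end

theorem matProd_self_succ (m : ℕ) (A : ℕ → Matrix (Fin m) (Fin m) ℝ) (t : ℕ) :
    matProd m A t (t + 1) = 1 := by
  simp [matProd]

theorem matProd_succ (m : ℕ) (A : ℕ → Matrix (Fin m) (Fin m) ℝ) (t τ : ℕ) (h : τ ≤ t + 1) :
    matProd m A (t + 1) τ = A (t + 1) * matProd m A t τ := by
  unfold matProd
  have e : t + 1 + 1 - τ = (t + 1 - τ) + 1 := by omega
  rw [e, List.range'_concat]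
  have e2 : τ + 1 * (t + 1 - τ) = t + 1 := by omega
  rw [e2]
  simp

theorem cov_formula (m q : ℕ)
    (A : ℕ → Matrix (Fin m) (Fin m) ℝ)
    (B : ℕ → Matrix (Fin m) (Fin q) ℝ)
    (Sθ : Matrix (Fin q) (Fin q) ℝ)
    (S : ℕ → Matrix (Fin m) (Fin m) ℝ)
    (hrec : ∀ t : ℕ, 1 ≤ t → S t = A t * S (t - 1) * (A t)ᵀ + B t * Sθ * (B t)ᵀ) (t : ℕ) :
    S t = matProd m A t 1 * S 0 * (matProd m A t 1)ᵀ +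
      ∑ k ∈ Finset.range t, (matProd m A t (k + 2) * B (k + 1)) * Sθ *
        (matProd m A t (k + 2) * B (k + 1))ᵀ := by
  induction t with
  | zero => simp [matProd]
  | succ t ih =>
    rw [hrec (t + 1) (by omega), Nat.add_sub_cancel, ih, Finset.sum_range_succ,
      matProd_self_succ, matProd_succ m A t 1 (by omega)]
    have : ∀ k ∈ Finset.range t, (matProd m A (t + 1) (k + 2) * B (k + 1)) * Sθ *
        (matProd m A (t + 1) (k + 2) * B (k + 1))ᵀ =
        A (t + 1) * ((matProd m A t (k + 2) * B (k + 1)) * Sθ *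
        (matProd m A t (k + 2) * B (k + 1))ᵀ) * (A (t + 1))ᵀ := by
      intro k hk
      rw [matProd_succ m A t (k + 2) (by have := Finset.mem_range.1 hk; omega)]
      simp only [Matrix.transpose_mul, Matrix.mul_assoc]
    rw [Finset.sum_congr rfl this, ← Finset.sum_mul, ← Finset.mul_sum, Matrix.one_mul,
      Matrix.mul_add, Matrix.add_mul, add_assoc]
    simp only [Matrix.transpose_mul, Matrix.mul_assoc]

theorem sum_inv_sq_le (t : ℕ) :
    ∑ k ∈ Finset.range t, 1 / ((k + 1 : ℕ) : ℝ) ^ 2 ≤ Real.pi ^ 2 / 6 := by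
  have h := sum_le_hasSum (Finset.range (t + 1)) (fun i _ => by positivity) hasSum_zeta_two
  rw [Finset.sum_range_succ'] at h
  simpa using h

/-- If `‖Φ(t,τ)‖ ≤ ā` for all `1 ≤ τ ≤ t+1` and `‖B(τ)‖ ≤ b/τ` for all
`τ ≥ 1`, then the covariance sequence is uniformly bounded:
`‖Σ(t)‖ ≤ ā²·‖Σ(0)‖ + ā²·‖Σ_θ‖·b²·π²/6` for every `t ≥ 0`. -/
theorem covariance_uniform_bound_decaying_B
    (m q : ℕ) (hm : 0 < m) (hq : 0 < q)
    (A : ℕ → Matrix (Fin m) (Fin m) ℝ)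
    (B : ℕ → Matrix (Fin m) (Fin q) ℝ)
    (Sθ : Matrix (Fin q) (Fin q) ℝ)
    (S : ℕ → Matrix (Fin m) (Fin m) ℝ)
    (hrec : ∀ t : ℕ, 1 ≤ t → S t = A t * S (t - 1) * (A t)ᵀ + B t * Sθ * (B t)ᵀ)
    (abar b : ℝ) (habar : 0 < abar) (hb : 0 < b)
    (hΦ : ∀ t τ : ℕ, 1 ≤ τ → τ ≤ t + 1 → matOpNorm (matProd m A t τ) ≤ abar)
    (hB : ∀ τ : ℕ, 1 ≤ τ → matOpNorm (B τ) ≤ b / τ) :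
    ∀ t : ℕ,
      matOpNorm (S t) ≤ abar ^ 2 * matOpNorm (S 0) +
        abar ^ 2 * matOpNorm Sθ * b ^ 2 * (Real.pi ^ 2 / 6) := by
  intro t
  rw [cov_formula m q A B Sθ S hrec t]
  refine (matOpNorm_add_sum_le _ _ _).trans ?_
  refine add_le_add ?_ ?_
  · refine (matOpNorm_sandwich _ _).trans ?_
    have := hΦ t 1 le_rfl (by omega)
    have h0 := matOpNorm_nonneg' (matProd m A t 1)
    have h1 := matOpNorm_nonneg' (S 0)
    gcongr
  · have h1 := matOpNorm_nonneg' Sθ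
    have key : ∀ k ∈ Finset.range t,
        matOpNorm ((matProd m A t (k + 2) * B (k + 1)) * Sθ *
          (matProd m A t (k + 2) * B (k + 1))ᵀ) ≤
        abar ^ 2 * matOpNorm Sθ * b ^ 2 * (1 / ((k + 1 : ℕ) : ℝ) ^ 2) := by
      intro k hk
      have hk := Finset.mem_range.1 hk
      have e1 := hΦ t (k + 2) (by omega) (by omega)
      have e2 := hB (k + 1) (by omega)
      have h2 := matOpNorm_nonneg' (B (k + 1))
      have h3 := matOpNorm_nonneg' (matProd m A t (k + 2) * B (k + 1))
      have e3 : matOpNorm (matProd m A t (k + 2) * B (k + 1)) ≤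
          abar * (b / ((k + 1 : ℕ) : ℝ)) :=
        (matOpNorm_mul_le' _ _).trans (by gcongr)
      calc _ ≤ _ := matOpNorm_sandwich _ _
        _ ≤ (abar * (b / ((k + 1 : ℕ) : ℝ))) ^ 2 * matOpNorm Sθ := by gcongr
        _ = _ := by ring
    refine (Finset.sum_le_sum key).trans ?_
    rw [← Finset.mul_sum]
    have := sum_inv_sq_le t
    gcongr
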